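/- Suppose each state forecast set is a nonempty product across time stages, X_i = Π_{t=1}^{T+1} X_{i,t} with nonempty X_{i,t} ⊆ ℝ^{n_i}, and suppose the policies Ψ_{i,t}(ξ_i^{t−1}, ζ_{N_i}^t) satisfy the local robust invariance condition: for every ξ_i ∈ Ξ_i and every ζ_{N_i} ∈ X_{N_i} := Π_{j∈N_i} X_j, the local closed-loop state trajectory of agent i lies in X_i. Define the interconnected closed-loop trajectories x̂_i(ξ), ξ ∈ Ξ, by the network dynamics with u_{i,t} = Ψ_{i,t}(ξ_i^{t−1}, x̂_{N_i}^t(ξ)), i.e. each agent applies its policy with the beliefs replaced by the actual neighbor state trajectories. Then x̂_i(ξ) ∈ X_i for every ξ ∈ Ξ and every i ∈ {1,…,M}. -/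

import Mathlib

open Matrix

/-- Data of a networked linear system with `M` agents and horizon `T`: state, input and
disturbance dimensions `n, m, d`, neighbor sets `nbr`, known initial states `xInit`, dynamics
matrices `A, B, D, E` (with `B i t j` the block of `B_{i,t}` acting on the states of neighbor
`j`), disturbance sets `unc i = Ξᵢ`, operational constraint sets `cns i = 𝒪ᵢ` and objective
functions `obj i = Jᵢ`.  Time is `0`-based: stage `k : Fin T` corresponds to time `t = k+1`
of the paper, so that the state trajectory is indexed by `Fin (T+1)`. -/
structure NetSys (M T : ℕ) where
  n : Fin M → ℕ
  m : Fin M → ℕ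
  d : Fin M → ℕ
  nbr : Fin M → Finset (Fin M)
  xInit : ∀ i, Fin (n i) → ℝ
  A : ∀ i, Fin T → Matrix (Fin (n i)) (Fin (n i)) ℝ
  B : ∀ i, Fin T → ∀ j, Matrix (Fin (n i)) (Fin (n j)) ℝ
  D : ∀ i, Fin T → Matrix (Fin (n i)) (Fin (m i)) ℝ
  E : ∀ i, Fin T → Matrix (Fin (n i)) (Fin (d i)) ℝ
  unc : ∀ i, Set (Fin T → Fin (d i) → ℝ)
  cns : ∀ i, Set ((Fin (T+1) → Fin (n i) → ℝ) × (Fin T → Fin (m i) → ℝ))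
  obj : ∀ i, (Fin (T+1) → Fin (n i) → ℝ) → (Fin T → Fin (m i) → ℝ) → ℝ

namespace NetSys

variable {M T : ℕ} (S : NetSys M T)

/-- A disturbance profile for all agents. -/
def Prof : Type := ∀ i, Fin T → Fin (S.d i) → ℝ

/-- Membership of a disturbance profile in `Ξ = Ξ₁ × ⋯ × Ξ_M`. -/
def memUnc (ξ : S.Prof) : Prop := ∀ i, ξ i ∈ S.unc i

/-- The interconnected network closed-loop equations for a given input profile `u`:
`x` is the closed-loop state trajectory profile. -/
def NetTraj (ξ : S.Prof) (u : ∀ i, Fin T → Fin (S.m i) → ℝ)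
    (x : ∀ i, Fin (T+1) → Fin (S.n i) → ℝ) : Prop :=
  ∀ i, x i 0 = S.xInit i ∧
    ∀ k : Fin T,
      x i k.succ =
        S.A i k *ᵥ x i k.castSucc +
        (∑ j ∈ (S.nbr i).attach, S.B i k j.1 *ᵥ x j.1 k.castSucc) +
        S.D i k *ᵥ u i k + S.E i k *ᵥ ξ i k


/-- Belief trajectories of the neighbors of agent `i`: for each neighbor `j ∈ Nᵢ`, a state
trajectory `ζⱼ` of agent `j`. -/
def Beliefs (i : Fin M) : Type :=
  (j : {j // j ∈ S.nbr i}) → Fin (T+1) → Fin (S.n j.1) → ℝ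

/-- Local information policies (Problem L): the input of agent `i` at stage `k` is a function
of its own disturbance trajectory and of the belief trajectories of its neighbors. -/
def LPol : Type :=
  ∀ i, Fin T → (Fin T → Fin (S.d i) → ℝ) → S.Beliefs i → Fin (S.m i) → ℝ

/-- Causality of a local information policy: strictly causal in the agent's own disturbances
(stages `< k`) and causal in the neighbors' beliefs (times `≤ k`). -/
def LCausal (Ψ : S.LPol) : Prop :=
  ∀ i (k : Fin T) (ξ ξ' : Fin T → Fin (S.d i) → ℝ) (ζ ζ' : S.Beliefs i),
    (∀ s : Fin T, (s : ℕ) < (k : ℕ) → ξ s = ξ' s) →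
    (∀ (j : {j // j ∈ S.nbr i}) (s : Fin (T+1)), (s : ℕ) ≤ (k : ℕ) → ζ j s = ζ' j s) →
    Ψ i k ξ ζ = Ψ i k ξ' ζ'

/-- The local closed-loop equations of agent `i`, with the belief trajectories `ζ`
substituted for the actual neighbor states. -/
def LocalTraj (i : Fin M) (ξi : Fin T → Fin (S.d i) → ℝ) (ζ : S.Beliefs i)
    (u : Fin T → Fin (S.m i) → ℝ) (x : Fin (T+1) → Fin (S.n i) → ℝ) : Prop :=
  x 0 = S.xInit i ∧
    ∀ k : Fin T,
      x k.succ =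
        S.A i k *ᵥ x k.castSucc +
        (∑ j ∈ (S.nbr i).attach, S.B i k j.1 *ᵥ ζ j k.castSucc) +
        S.D i k *ᵥ u k + S.E i k *ᵥ ξi k

end NetSys

namespace NetSys

/-- The local closed-loop equations have a solution for every belief and every input. -/
theorem exists_localTraj {M T : ℕ} (S : NetSys M T) (i : Fin M)
    (ξi : Fin T → Fin (S.d i) → ℝ) (ζ : S.Beliefs i) (u : Fin T → Fin (S.m i) → ℝ) :
    ∃ x, S.LocalTraj i ξi ζ u x :=
  ⟨fun t => Fin.induction (motive := fun _ => Fin (S.n i) → ℝ) (S.xInit i)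
    (fun k y => S.A i k *ᵥ y + (∑ j ∈ (S.nbr i).attach, S.B i k j.1 *ᵥ ζ j k.castSucc) +
      S.D i k *ᵥ u k + S.E i k *ᵥ ξi k) t, rfl, fun _ => rfl⟩

/-- If beliefs and inputs agree before time `t`, so do the local closed-loop states up to
time `t`. -/
theorem LocalTraj.eq_of_agree {M T : ℕ} {S : NetSys M T} {i : Fin M}
    {ξi : Fin T → Fin (S.d i) → ℝ} {ζ ζ' : S.Beliefs i} {u u' : Fin T → Fin (S.m i) → ℝ}
    {x x' : Fin (T+1) → Fin (S.n i) → ℝ}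
    (h : S.LocalTraj i ξi ζ u x) (h' : S.LocalTraj i ξi ζ' u' x') (t : Fin (T+1))
    (hζ : ∀ j, ∀ s < t, ζ j s = ζ' j s) (hu : ∀ k : Fin T, k.castSucc < t → u k = u' k) :
    x t = x' t := by
  induction t using Fin.induction with
  | zero => rw [h.1, h'.1]
  | succ k ih =>
    have hk : k.castSucc < k.succ := Fin.castSucc_lt_succ
    rw [h.2, h'.2, hu k hk, ih (fun j s hs => hζ j s (hs.trans hk))
      (fun l hl => hu l (hl.trans hk))]
    simp only [hζ _ _ hk]

end NetSys

/-- network invariance claim underlying Theorem 3, for stage-wise product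
forecast sets: if each state forecast set is a nonempty product `Xᵢ = Π_t X_{i,t}` and the
policies `Ψ` satisfy the local robust invariance condition, then the interconnected
closed-loop trajectories (obtained by feeding each agent its actual neighbor states as
beliefs) remain in the forecast sets. -/
theorem stmt11 {M T : ℕ} (S : NetSys M T)
    (hne : ∀ i, (S.unc i).Nonempty)
    (Xt : ∀ i, Fin (T+1) → Set (Fin (S.n i) → ℝ))
    (hXt : ∀ i t, (Xt i t).Nonempty)
    (Ψ : S.LPol) (hΨ : S.LCausal Ψ)
    (hinv : ∀ i (ξi : Fin T → Fin (S.d i) → ℝ), ξi ∈ S.unc i →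
      ∀ ζ : S.Beliefs i, (∀ j (t : Fin (T+1)), ζ j t ∈ Xt j.1 t) →
      ∀ x, S.LocalTraj i ξi ζ (fun k => Ψ i k ξi ζ) x →
        ∀ t, x t ∈ Xt i t) :
    ∀ ξ, S.memUnc ξ →
      ∀ x, S.NetTraj ξ (fun i k => Ψ i k (ξ i) (fun j => x j.1)) x →
        ∀ i (t : Fin (T+1)), x i t ∈ Xt i t := by
  classical
  intro ξ hξ x hx i t
  induction t using WellFoundedLT.induction generalizing i with
  | ind t ih =>
    choose c hc using hXt
    let ζ : S.Beliefs i := fun j s => if s < t then x j.1 s else c j.1 s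
    have hζx : ∀ j, ∀ s < t, ζ j s = x j.1 s := fun j s hs => if_pos hs
    have hζ : ∀ j s, ζ j s ∈ Xt j.1 s := by
      intro j s
      by_cases hs : s < t
      · rw [hζx j s hs]
        exact ih s hs j.1
      · simpa only [ζ, if_neg hs] using hc j.1 s
    obtain ⟨y, hy⟩ := S.exists_localTraj i (ξ i) ζ (fun k => Ψ i k (ξ i) ζ)
    have hxi : S.LocalTraj i (ξ i) (fun j => x j.1)
        (fun k => Ψ i k (ξ i) (fun j => x j.1)) (x i) := hx i
    rw [← hy.eq_of_agree hxi t hζx fun k hk => hΨ i k _ _ _ _ (fun _ _ => rfl)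
      fun j s hs => hζx j s (lt_of_le_of_lt (b := k.castSucc) hs hk)]
    exact hinv i (ξ i) (hξ i) ζ hζ y hy t
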